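/- Let 1 < p < 2 and let B ⊂ ℝⁿ be a ball. Then there exists a constant c ≥ 1, depending only on n, N and p, such that for every measurable map g : ℝⁿ → ℝ^{N×n} with |g|^p integrable on B one has |V_p((g)_B) − (V_p(g))_B| ≤ (⨍_B |V_p(g) − V_p((g)_B)|² dx)^{1/2} ≤ c 𝔉(g;B). -/

import Mathlib

open MeasureTheory

/-- `V_p(z) := |z|^{(p−2)/2} z` on the (Euclidean) space `ℝ^{N×n}` (with `V_p(0)=0`). -/
noncomputable def Vp {ι : Type*} [Fintype ι] (p : ℝ) (z : EuclideanSpace ℝ ι) :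
    EuclideanSpace ℝ ι :=
  (‖z‖ ^ ((p - 2) / 2)) • z

/-- The excess functional `𝔉(g;B) := (⨍_B |V_p(g) − (V_p(g))_B|² dx)^{1/2}`. -/
noncomputable def excess {n : ℕ} {ι : Type*} [Fintype ι] (p : ℝ)
    (g : EuclideanSpace ℝ (Fin n) → EuclideanSpace ℝ ι)
    (B : Set (EuclideanSpace ℝ (Fin n))) : ℝ :=
  (⨍ x in B, ‖Vp p (g x) - ⨍ y in B, Vp p (g y) ∂volume‖ ^ 2 ∂volume) ^ (1 / 2 : ℝ)

section helpers

variable {ι : Type*} [Fintype ι]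

lemma Vp_aux_upper {p : ℝ} (hp : 1 < p) (hp2 : p < 2) (a b : EuclideanSpace ℝ ι)
    (hab : ‖b‖ ≤ ‖a‖) (ha : 0 < ‖a‖) :
    ‖Vp p a - Vp p b‖ ≤ 2 * (‖a‖ ^ ((p - 2) / 2) * ‖a - b‖) := by
  unfold Vp
  set α := (p - 2) / 2 with hα
  have h1 : ‖a‖ ^ α • a - ‖b‖ ^ α • b = ‖a‖ ^ α • (a - b) - (‖b‖ ^ α - ‖a‖ ^ α) • b := by
    module
  have h2 : ‖(‖b‖ ^ α - ‖a‖ ^ α) • b‖ ≤ ‖a‖ ^ α * ‖a - b‖ := by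
    rcases eq_or_lt_of_le (norm_nonneg b) with hb | hb
    · have : b = 0 := by simpa using hb.symm
      subst this
      simp only [smul_zero, norm_zero]; positivity
    · have h3 : ‖a‖ ^ α ≤ ‖b‖ ^ α := Real.rpow_le_rpow_of_nonpos hb hab (by linarith)
      rw [norm_smul, Real.norm_of_nonneg (by linarith)]
      have h4 : ‖b‖ ^ (α + 1) ≤ ‖a‖ ^ (α + 1) :=
        Real.rpow_le_rpow hb.le hab (by linarith)
      rw [Real.rpow_add_one hb.ne', Real.rpow_add_one ha.ne'] at h4
      have h5 : ‖a‖ - ‖b‖ ≤ ‖a - b‖ := norm_sub_norm_le a b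
      have h6 : 0 ≤ ‖a‖ ^ α := by positivity
      nlinarith
  have h7 : ‖‖a‖ ^ α • (a - b)‖ = ‖a‖ ^ α * ‖a - b‖ := by
    rw [norm_smul, Real.norm_of_nonneg (by positivity)]
  rw [h1]
  have := norm_sub_le (‖a‖ ^ α • (a - b)) ((‖b‖ ^ α - ‖a‖ ^ α) • b)
  linarith

lemma Vp_aux_lower {p : ℝ} (hp : 1 < p) (hp2 : p < 2) (a b : EuclideanSpace ℝ ι)
    (hab : ‖b‖ ≤ ‖a‖) (ha : 0 < ‖a‖) :
    ‖a‖ ^ ((p - 2) / 2) * ‖a - b‖ ≤ 2 * ‖Vp p a - Vp p b‖ := by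
  have h0 := norm_sub_norm_le (Vp p a) (Vp p b)
  unfold Vp at *
  set α := (p - 2) / 2 with hα
  have h1 : ‖a‖ ^ α • (a - b) = (‖a‖ ^ α • a - ‖b‖ ^ α • b) + (‖b‖ ^ α - ‖a‖ ^ α) • b := by
    module
  rw [norm_smul, norm_smul, Real.norm_of_nonneg (by positivity),
    Real.norm_of_nonneg (by positivity)] at h0
  have h2 : ‖(‖b‖ ^ α - ‖a‖ ^ α) • b‖ ≤ ‖a‖ ^ α * ‖a‖ - ‖b‖ ^ α * ‖b‖ := by
    rcases eq_or_lt_of_le (norm_nonneg b) with hb | hb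
    · have : b = 0 := by simpa using hb.symm
      subst this
      simp only [smul_zero, norm_zero, mul_zero, sub_zero]; positivity
    · have h3 : ‖a‖ ^ α ≤ ‖b‖ ^ α := Real.rpow_le_rpow_of_nonpos hb hab (by linarith)
      rw [norm_smul, Real.norm_of_nonneg (by linarith)]
      have h4 : ‖b‖ ^ (α + α + 1) ≤ ‖a‖ ^ (α + α + 1) :=
        Real.rpow_le_rpow hb.le hab (by linarith)
      rw [Real.rpow_add_one hb.ne', Real.rpow_add_one ha.ne', Real.rpow_add hb,
        Real.rpow_add ha] at h4
      have hA : 0 < ‖a‖ ^ α := by positivity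
      have hB : 0 < ‖b‖ ^ α := by positivity
      generalize ‖a‖ ^ α = x at *
      generalize ‖b‖ ^ α = y at *
      generalize ‖a‖ = A at *
      generalize ‖b‖ = B at *
      -- goal `2 y B ≤ x A + x B`
      have h5 : (y * B) ^ 2 ≤ (x * A) * (x * B) := by nlinarith
      have h6 : 2 * (y * B) ≤ x * A + x * B := by
        refine (pow_le_pow_iff_left₀ (by positivity) (by positivity) two_ne_zero).1 ?_
        nlinarith [sq_nonneg (x * A - x * B)]
      nlinarith
  have h7 : ‖‖a‖ ^ α • (a - b)‖ = ‖a‖ ^ α * ‖a - b‖ := by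
    rw [norm_smul, Real.norm_of_nonneg (by positivity)]
  rw [← h7, h1]
  have := norm_add_le (‖a‖ ^ α • a - ‖b‖ ^ α • b) ((‖b‖ ^ α - ‖a‖ ^ α) • b)
  linarith

lemma sq_rpow_half {p x : ℝ} (hx : 0 ≤ x) : (x ^ ((p - 2) / 2)) ^ 2 = x ^ (p - 2) := by
  rw [← Real.rpow_natCast, ← Real.rpow_mul hx]
  congr 1
  push_cast
  ring

lemma Vp_upper {p : ℝ} (hp : 1 < p) (hp2 : p < 2) (a b : EuclideanSpace ℝ ι) :
    ‖Vp p a - Vp p b‖ ^ 2 ≤ 48 * (‖a - b‖ ^ 2 * (2 * ‖b‖ + ‖a - b‖) ^ (p - 2)) := by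
  have key : ∀ M : ℝ, 0 < M → 2 * ‖b‖ + ‖a - b‖ ≤ 4 * M → 0 < 2 * ‖b‖ + ‖a - b‖ →
      ‖Vp p a - Vp p b‖ ≤ 2 * (M ^ ((p - 2) / 2) * ‖a - b‖) →
      ‖Vp p a - Vp p b‖ ^ 2 ≤ 48 * (‖a - b‖ ^ 2 * (2 * ‖b‖ + ‖a - b‖) ^ (p - 2)) := by
    intro M hM h1 h0 h2
    have h3 : (4 * M) ^ (p - 2) ≤ (2 * ‖b‖ + ‖a - b‖) ^ (p - 2) :=
      Real.rpow_le_rpow_of_nonpos h0 h1 (by linarith)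
    rw [Real.mul_rpow (by norm_num) hM.le] at h3
    have h4 : (4:ℝ) ^ (-1:ℝ) ≤ 4 ^ (p - 2) :=
      Real.rpow_le_rpow_of_exponent_le (by norm_num) (by linarith)
    rw [Real.rpow_neg_one] at h4
    have h5 : 0 ≤ M ^ (p - 2) := by positivity
    have h6 : M ^ (p - 2) ≤ 4 * (2 * ‖b‖ + ‖a - b‖) ^ (p - 2) := by nlinarith
    have h7 : ‖Vp p a - Vp p b‖ ^ 2 ≤ (2 * (M ^ ((p - 2) / 2) * ‖a - b‖)) ^ 2 :=
      pow_le_pow_left₀ (norm_nonneg _) h2 2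
    have h8 : (2 * (M ^ ((p - 2) / 2) * ‖a - b‖)) ^ 2 = 4 * (M ^ (p - 2) * ‖a - b‖ ^ 2) := by
      rw [mul_pow, mul_pow, sq_rpow_half hM.le]; norm_num
    have h9 : 0 ≤ (2 * ‖b‖ + ‖a - b‖) ^ (p - 2) := by positivity
    have h10 := mul_le_mul_of_nonneg_right h6 (sq_nonneg ‖a - b‖)
    have h11 := mul_nonneg h9 (sq_nonneg ‖a - b‖)
    nlinarith
  by_cases hd : a = b
  · subst hd; simp
  have hd' : 0 < ‖a - b‖ := norm_pos_iff.2 (sub_ne_zero.2 hd)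
  have hb := norm_nonneg b
  have ha := norm_nonneg a
  have h1 := norm_sub_le a b
  rcases le_total ‖b‖ ‖a‖ with h | h
  · have hM : 0 < ‖a‖ := by linarith
    exact key ‖a‖ hM (by linarith) (by linarith) (Vp_aux_upper hp hp2 a b h hM)
  · have hM : 0 < ‖b‖ := by linarith
    refine key ‖b‖ hM (by linarith) (by linarith) ?_
    rw [norm_sub_rev, norm_sub_rev a b]
    exact Vp_aux_upper hp hp2 b a h hM

lemma Vp_lower {p : ℝ} (hp : 1 < p) (hp2 : p < 2) (a b : EuclideanSpace ℝ ι) :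
    ‖a - b‖ ^ 2 * (2 * ‖b‖ + ‖a - b‖) ^ (p - 2) ≤ 4 * ‖Vp p a - Vp p b‖ ^ 2 := by
  have key : ∀ M : ℝ, 0 < M → M ≤ 2 * ‖b‖ + ‖a - b‖ →
      M ^ ((p - 2) / 2) * ‖a - b‖ ≤ 2 * ‖Vp p a - Vp p b‖ →
      ‖a - b‖ ^ 2 * (2 * ‖b‖ + ‖a - b‖) ^ (p - 2) ≤ 4 * ‖Vp p a - Vp p b‖ ^ 2 := by
    intro M hM h1 h2
    have h3 : (2 * ‖b‖ + ‖a - b‖) ^ (p - 2) ≤ M ^ (p - 2) :=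
      Real.rpow_le_rpow_of_nonpos hM h1 (by linarith)
    have h7 := pow_le_pow_left₀ (by positivity) h2 2
    rw [mul_pow, sq_rpow_half hM.le, mul_pow] at h7
    have h10 := mul_le_mul_of_nonneg_right h3 (sq_nonneg ‖a - b‖)
    linarith
  by_cases hd : a = b
  · subst hd; simp
  have hd' : 0 < ‖a - b‖ := norm_pos_iff.2 (sub_ne_zero.2 hd)
  have hb := norm_nonneg b
  have ha := norm_nonneg a
  have h1 := norm_sub_le a b
  have h2 := norm_sub_norm_le a b
  rcases le_total ‖b‖ ‖a‖ with h | h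
  · have hM : 0 < ‖a‖ := by linarith
    exact key ‖a‖ hM (by linarith) (Vp_aux_lower hp hp2 a b h hM)
  · have hM : 0 < ‖b‖ := by linarith
    refine key ‖b‖ hM (by linarith) ?_
    rw [norm_sub_rev, norm_sub_rev (Vp p a)]
    exact Vp_aux_lower hp hp2 b a h hM

lemma Vp_surj {p : ℝ} (hp : 1 < p) (A : EuclideanSpace ℝ ι) :
    ∃ ξ, Vp p ξ = A := by
  by_cases hA : A = 0
  · exact ⟨0, by simp [Vp, hA]⟩
  have hA' : 0 < ‖A‖ := norm_pos_iff.2 hA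
  set α := (p - 2) / 2 with hα
  have hα1 : 1 + α ≠ 0 := by linarith
  refine ⟨‖A‖ ^ (-α / (1 + α)) • A, ?_⟩
  unfold Vp
  rw [← hα, norm_smul, Real.norm_of_nonneg (by positivity), smul_smul]
  have h1 : ‖A‖ ^ (-α / (1 + α)) * ‖A‖ = ‖A‖ ^ (1 / (1 + α)) := by
    rw [← Real.rpow_add_one hA'.ne']
    congr 1
    field_simp
    ring
  rw [h1, ← Real.rpow_mul hA'.le, ← Real.rpow_add hA']
  have : 1 / (1 + α) * α + -α / (1 + α) = 0 := by field_simp; ring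
  rw [this]; simp

lemma tangent {p : ℝ} (hp : 1 < p) (hp2 : p < 2) {a t : ℝ} (ha : 0 ≤ a) (ht : 0 ≤ t) :
    ∃ k : ℝ, 0 ≤ k ∧ ∀ d : ℝ, 0 ≤ d →
      t ^ 2 * (a + t) ^ (p - 2) + k * (d - t) ≤ d ^ 2 * (a + d) ^ (p - 2) := by
  rcases eq_or_lt_of_le ht with h | ht
  · refine ⟨0, le_rfl, fun d hd => ?_⟩
    rw [← h]
    simp only [ne_eq, OfNat.ofNat_ne_zero, not_false_eq_true, zero_pow, zero_mul, add_zero]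
    positivity
  have hs : 0 < a + t := by linarith
  set s := a + t with hsdef
  have hS : 0 < s ^ (p - 2) := by positivity
  set R := s ^ (p - 2) with hR
  have hts : t / s ≤ 1 := by rw [div_le_one hs]; linarith
  have hts0 : 0 ≤ t / s := by positivity
  refine ⟨t * R * (2 - (2 - p) * (t / s)), ?_, fun d hd => ?_⟩
  · apply mul_nonneg (by positivity)
    nlinarith
  have hw0 : 0 ≤ a + d := by linarith
  rcases eq_or_lt_of_le hw0 with h | hw
  · have hd0 : d = 0 := by linarith
    have ha0 : a = 0 := by linarith
    have : t / s = 1 := by rw [div_eq_one_iff_eq hs.ne']; linarith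
    rw [this, hd0]
    have : 0 < t ^ 2 * R := by positivity
    norm_num
    nlinarith
  set w := a + d with hwdef
  -- Bernoulli
  have hB : (w / s) ^ (2 - p) ≤ 1 + (2 - p) * (w / s - 1) := by
    have := rpow_one_add_le_one_add_mul_self (s := w / s - 1) (p := 2 - p)
      (by have : 0 ≤ w / s := by positivity
          linarith) (by linarith) (by linarith)
    simpa using this
  have hWR : w ^ (p - 2) * (w / s) ^ (2 - p) = R := by
    rw [Real.div_rpow hw.le hs.le, hR, show (2 - p) = -(p - 2) by ring, Real.rpow_neg hw.le,
      Real.rpow_neg hs.le]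
    have : w ^ (p - 2) ≠ 0 := by positivity
    field_simp
  have hW : 0 < w ^ (p - 2) := by positivity
  set W := w ^ (p - 2) with hWd
  have hv : 0 < (w / s) ^ (2 - p) := by positivity
  set v := (w / s) ^ (2 - p) with hvd
  have h1 : w / s - 1 = (d - t) / s := by
    rw [hwdef]; field_simp; rw [hsdef]; ring
  rw [h1] at hB
  -- d^2 W ≥ 2 d t R - t^2 R v
  have h2 : 2 * d * t * R - t ^ 2 * R * v ≤ d ^ 2 * W := by
    rw [← hWR]
    nlinarith [mul_nonneg hW.le (sq_nonneg (d - t * v))]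
  have h3 : t ^ 2 * R * v ≤ t ^ 2 * R * (1 + (2 - p) * ((d - t) / s)) :=
    mul_le_mul_of_nonneg_left hB (by positivity)
  have h4 : t ^ 2 * R + t * R * (2 - (2 - p) * (t / s)) * (d - t)
      = 2 * d * t * R - t ^ 2 * R * (1 + (2 - p) * ((d - t) / s)) := by
    field_simp; ring
  linarith

lemma Vp_norm_sq {p : ℝ} (hp : 1 < p) (z : EuclideanSpace ℝ ι) :
    ‖Vp p z‖ ^ 2 = ‖z‖ ^ p := by
  unfold Vp
  rw [norm_smul, Real.norm_of_nonneg (by positivity), mul_pow, sq_rpow_half (norm_nonneg z)]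
  rcases eq_or_lt_of_le (norm_nonneg z) with h | h
  · rw [← h, Real.zero_rpow (by linarith : p ≠ 0)]; simp
  · rw [← Real.rpow_natCast ‖z‖ 2, ← Real.rpow_add h]; congr 1; push_cast; ring

lemma Vp_measurable (p : ℝ) : Measurable (Vp p : EuclideanSpace ℝ ι → EuclideanSpace ℝ ι) := by
  unfold Vp
  exact (measurable_norm.pow_const _).smul measurable_id

lemma norm_integral_sq_le {Ω E : Type*} [MeasurableSpace Ω] [NormedAddCommGroup E]
    [NormedSpace ℝ E] (μ : Measure Ω)
    [IsProbabilityMeasure μ] (f : Ω → E) (hf : Integrable f μ)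
    (hf2 : Integrable (fun x => ‖f x‖ ^ 2) μ) :
    ‖∫ x, f x ∂μ‖ ^ 2 ≤ ∫ x, ‖f x‖ ^ 2 ∂μ := by
  set t := ‖∫ x, f x ∂μ‖ with ht
  have h1 : t ≤ ∫ x, ‖f x‖ ∂μ := norm_integral_le_integral_norm f
  have h2 : ∫ x, (2 * t * ‖f x‖ - t ^ 2) ∂μ ≤ ∫ x, ‖f x‖ ^ 2 ∂μ := by
    apply integral_mono ((hf.norm.const_mul _).sub (integrable_const _)) hf2
    intro x
    change 2 * t * ‖f x‖ - t ^ 2 ≤ ‖f x‖ ^ 2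
    nlinarith [sq_nonneg (‖f x‖ - t)]
  rw [integral_sub (hf.norm.const_mul _) (integrable_const _), integral_const_mul] at h2
  simp only [integral_const, probReal_univ, one_smul] at h2
  have : 0 ≤ t := norm_nonneg _
  nlinarith

lemma Vp_prob {Ω : Type*} [MeasurableSpace Ω] (μ : Measure Ω) [IsProbabilityMeasure μ]
    {p : ℝ} (hp : 1 < p) (hp2 : p < 2) (g : Ω → EuclideanSpace ℝ ι) (hg : Measurable g)
    (hgp : Integrable (fun x => ‖g x‖ ^ p) μ) :
    ‖Vp p (∫ y, g y ∂μ) - ∫ y, Vp p (g y) ∂μ‖ ≤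
        (∫ x, ‖Vp p (g x) - Vp p (∫ y, g y ∂μ)‖ ^ 2 ∂μ) ^ (1 / 2 : ℝ) ∧
      (∫ x, ‖Vp p (g x) - Vp p (∫ y, g y ∂μ)‖ ^ 2 ∂μ) ^ (1 / 2 : ℝ) ≤
        20 * (∫ x, ‖Vp p (g x) - ∫ y, Vp p (g y) ∂μ‖ ^ 2 ∂μ) ^ (1 / 2 : ℝ) := by
  have hgi : Integrable g μ := by
    refine ((integrable_const (1:ℝ)).add hgp).mono' hg.aestronglyMeasurable ?_
    refine Filter.Eventually.of_forall fun x => ?_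
    simp only [Pi.add_apply]
    rcases le_total ‖g x‖ 1 with h | h
    · have : 0 ≤ ‖g x‖ ^ p := by positivity
      linarith
    · have := Real.rpow_le_rpow_of_exponent_le h hp.le
      rw [Real.rpow_one] at this
      linarith
  have hVm : Measurable (fun x => Vp p (g x)) := (Vp_measurable p).comp hg
  have hV2 : MemLp (fun x => Vp p (g x)) 2 μ := by
    rw [memLp_two_iff_integrable_sq_norm hVm.aestronglyMeasurable]
    simpa only [Vp_norm_sq hp] using hgp
  have hVi : Integrable (fun x => Vp p (g x)) μ := hV2.integrable (by norm_num)
  have hsub : ∀ z : EuclideanSpace ℝ ι, Integrable (fun x => ‖Vp p (g x) - z‖ ^ 2) μ := by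
    intro z
    have : MemLp (fun x => Vp p (g x) - z) 2 μ := hV2.sub (memLp_const z)
    exact (memLp_two_iff_integrable_sq_norm this.1).1 this
  set m := ∫ y, g y ∂μ with hm
  set A := ∫ y, Vp p (g y) ∂μ with hA
  simp only [← Real.sqrt_eq_rpow]
  constructor
  · apply Real.le_sqrt_of_sq_le
    have := norm_integral_sq_le μ (fun x => Vp p (g x) - Vp p m)
      (hVi.sub (integrable_const _)) (hsub _)
    rw [integral_sub hVi (integrable_const _)] at this
    simp only [integral_const, probReal_univ, one_smul] at this
    rwa [norm_sub_rev]
  · obtain ⟨ξ, hξ⟩ := Vp_surj hp A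
    set D := ∫ x, ‖Vp p (g x) - A‖ ^ 2 ∂μ with hD
    have hD0 : 0 ≤ D := integral_nonneg fun x => by positivity
    obtain ⟨k, hk, htan⟩ := tangent hp hp2 (a := 2 * ‖ξ‖) (t := ‖m - ξ‖) (by positivity)
      (by positivity)
    have hdi : Integrable (fun x => g x - ξ) μ := hgi.sub (integrable_const _)
    have hT : ‖m - ξ‖ ≤ ∫ x, ‖g x - ξ‖ ∂μ := by
      have := norm_integral_le_integral_norm (μ := μ) (fun x => g x - ξ)
      rw [integral_sub hgi (integrable_const _)] at this
      simpa only [integral_const, probReal_univ, one_smul] using this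
    set H := ‖m - ξ‖ ^ 2 * (2 * ‖ξ‖ + ‖m - ξ‖) ^ (p - 2) with hH
    have h2 := Vp_upper hp hp2 m ξ
    rw [hξ, ← hH] at h2
    clear_value H
    have hki : Integrable (fun x => k * (‖g x - ξ‖ - ‖m - ξ‖)) μ :=
      (hdi.norm.sub (integrable_const _)).const_mul _
    have hint : ∫ x, (H + k * (‖g x - ξ‖ - ‖m - ξ‖)) ∂μ ≤ ∫ x, 4 * ‖Vp p (g x) - A‖ ^ 2 ∂μ := by
      apply integral_mono ((integrable_const _).add
        ((hdi.norm.sub (integrable_const _)).const_mul _)) ((hsub A).const_mul 4)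
      intro x
      have h1 := Vp_lower hp hp2 (g x) ξ
      rw [hξ] at h1
      exact (htan _ (norm_nonneg _)).trans h1
    rw [integral_add (integrable_const _) hki,
      integral_const_mul k, integral_const_mul 4, integral_sub hdi.norm (integrable_const _)] at hint
    simp only [integral_const, probReal_univ, one_smul] at hint
    rw [← hD] at hint
    have h2' := mul_nonneg hk (sub_nonneg.2 hT)
    have h3 : ‖Vp p m - A‖ ^ 2 ≤ 192 * D := by linarith
    have h4 : ∫ x, ‖Vp p (g x) - Vp p m‖ ^ 2 ∂μ
        ≤ ∫ x, (2 * ‖Vp p (g x) - A‖ ^ 2 + 2 * ‖Vp p m - A‖ ^ 2) ∂μ := by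
      apply integral_mono (hsub _) (((hsub A).const_mul 2).add (integrable_const _))
      intro x
      change ‖Vp p (g x) - Vp p m‖ ^ 2 ≤ 2 * ‖Vp p (g x) - A‖ ^ 2 + 2 * ‖Vp p m - A‖ ^ 2
      have h5 : ‖Vp p (g x) - Vp p m‖ ≤ ‖Vp p (g x) - A‖ + ‖Vp p m - A‖ := by
        rw [norm_sub_rev (Vp p m)]
        exact norm_sub_le_norm_sub_add_norm_sub _ _ _
      have h6 := pow_le_pow_left₀ (norm_nonneg _) h5 2
      nlinarith [sq_nonneg (‖Vp p (g x) - A‖ - ‖Vp p m - A‖)]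
    rw [integral_add ((hsub A).const_mul 2) (integrable_const _), integral_const_mul] at h4
    simp only [integral_const, probReal_univ, one_smul] at h4
    apply Real.sqrt_le_iff.2
    refine ⟨by positivity, ?_⟩
    rw [mul_pow, Real.sq_sqrt hD0]
    linarith

end helpers

/-- For `1 < p < 2` there is `c = c(n,N,p) ≥ 1` such that for every ball `B ⊂ ℝⁿ`
and every measurable `g` with `|g|^p` integrable on `B`,
`|V_p((g)_B) − (V_p(g))_B| ≤ (⨍_B |V_p(g) − V_p((g)_B)|²)^{1/2} ≤ c 𝔉(g;B)`. -/
theorem Vp_mean_comparison (n N : ℕ) (hn : 1 ≤ n) (hN : 1 ≤ N)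
    (p : ℝ) (hp : 1 < p) (hp2 : p < 2) :
    ∃ c : ℝ, 1 ≤ c ∧
      ∀ (x₀ : EuclideanSpace ℝ (Fin n)) (ρ : ℝ), 0 < ρ →
        ∀ g : EuclideanSpace ℝ (Fin n) → EuclideanSpace ℝ (Fin N × Fin n),
          Measurable g →
          IntegrableOn (fun x => ‖g x‖ ^ p) (Metric.ball x₀ ρ) volume →
          ‖Vp p (⨍ y in Metric.ball x₀ ρ, g y ∂volume) -
              ⨍ y in Metric.ball x₀ ρ, Vp p (g y) ∂volume‖ ≤
              (⨍ x in Metric.ball x₀ ρ,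
                ‖Vp p (g x) - Vp p (⨍ y in Metric.ball x₀ ρ, g y ∂volume)‖ ^ 2
                  ∂volume) ^ (1 / 2 : ℝ) ∧
            (⨍ x in Metric.ball x₀ ρ,
                ‖Vp p (g x) - Vp p (⨍ y in Metric.ball x₀ ρ, g y ∂volume)‖ ^ 2
                  ∂volume) ^ (1 / 2 : ℝ) ≤
              c * excess p g (Metric.ball x₀ ρ) := by
  refine ⟨20, by norm_num, ?_⟩
  intro x₀ ρ hρ g hg hgp
  set ν : Measure (EuclideanSpace ℝ (Fin n)) := volume.restrict (Metric.ball x₀ ρ) with hν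
  have hpos : volume (Metric.ball x₀ ρ) ≠ 0 := (Metric.measure_ball_pos volume x₀ hρ).ne'
  have hfin : volume (Metric.ball x₀ ρ) ≠ ⊤ := measure_ball_lt_top.ne
  haveI : IsProbabilityMeasure ((ν Set.univ)⁻¹ • ν) := by
    constructor
    rw [Measure.smul_apply, smul_eq_mul, hν, Measure.restrict_apply_univ]
    exact ENNReal.inv_mul_cancel hpos hfin
  have hgp' : Integrable (fun x => ‖g x‖ ^ p) ((ν Set.univ)⁻¹ • ν) := by
    apply Integrable.smul_measure hgp
    rw [hν, Measure.restrict_apply_univ]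
    exact ENNReal.inv_ne_top.2 hpos
  exact Vp_prob ((ν Set.univ)⁻¹ • ν) hp hp2 g hg hgp'
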